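/- Let G be a connected vertex-transitive non-bipartite triangle-free simple graph of degree 6 and even order that is not 4-factor-critical, and suppose λ₅(G) = λ₈(G) = 18. Then every λ₈-atom S of G satisfies |S| ≥ 15. -/

import Mathlib

open SimpleGraph

section Defs

variable {V : Type*}

/-- A simple graph is vertex-transitive if any vertex can be mapped to any other
by a graph automorphism. -/
def VertexTransitive (G : SimpleGraph V) : Prop :=
  ∀ x y : V, ∃ φ : G ≃g G, φ x = y

/-- A graph is `p`-factor-critical if the removal of any set of `p` vertices
results in a graph with a perfect matching. -/
def PFactorCritical (G : SimpleGraph V) (p : ℕ) : Prop :=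
  ∀ X : Set V, X.ncard = p → ∃ M : (G.induce Xᶜ).Subgraph, M.IsPerfectMatching

/-- A graph is factor-critical if the removal of any single vertex results in a
graph with a perfect matching. -/
def IsFactorCritical {W : Type*} (H : SimpleGraph W) : Prop :=
  ∀ v : W, ∃ M : (H.induce ({v}ᶜ : Set W)).Subgraph, M.IsPerfectMatching

/-- `∇(X)`: the set of edges of `G` with exactly one end in `X`. -/
def edgeBoundary (G : SimpleGraph V) (X : Set V) : Set (Sym2 V) :=
  {e | e ∈ G.edgeSet ∧ ∃ x ∈ X, ∃ y ∈ Xᶜ, e = s(x, y)}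

/-- The set of edges of `G` with both ends in `X`. -/
def edgesWithin (G : SimpleGraph V) (X : Set V) : Set (Sym2 V) :=
  {e | e ∈ G.edgeSet ∧ ∀ v ∈ e, v ∈ X}

/-- The set of edges of `G` with one end in `A` and the other end in `S \ A`
(i.e. the edge boundary of `A` inside the induced subgraph `G[S]` when `A ⊆ S`). -/
def inducedEdgeBoundary (G : SimpleGraph V) (S A : Set V) : Set (Sym2 V) :=
  {e | e ∈ G.edgeSet ∧ ∃ x ∈ A, ∃ y ∈ S \ A, e = s(x, y)}

/-- `F` is an `s`-restricted edge-cut of `G` if deleting `F` disconnects `G` and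
every component of `G − F` has at least `s` vertices. -/
def IsRestrictedEdgeCut (G : SimpleGraph V) (s : ℕ) (F : Set (Sym2 V)) : Prop :=
  F ⊆ G.edgeSet ∧ ¬ (G.deleteEdges F).Connected ∧
    ∀ c : (G.deleteEdges F).ConnectedComponent, s ≤ c.supp.ncard

/-- `λ_s(G)`: the minimum cardinality of an `s`-restricted edge-cut of `G`. -/
noncomputable def lambdaS (G : SimpleGraph V) (s : ℕ) : ℕ :=
  sInf (Set.ncard '' {F | IsRestrictedEdgeCut G s F})

/-- A `λ_s`-fragment: a vertex set whose edge boundary is an `s`-restricted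
edge-cut of minimum cardinality `λ_s(G)`. -/
def IsLambdaFragment (G : SimpleGraph V) (s : ℕ) (X : Set V) : Prop :=
  IsRestrictedEdgeCut G s (edgeBoundary G X) ∧ (edgeBoundary G X).ncard = lambdaS G s

/-- A `λ_s`-atom: a `λ_s`-fragment of minimum cardinality. -/
def IsLambdaAtom (G : SimpleGraph V) (s : ℕ) (X : Set V) : Prop :=
  IsLambdaFragment G s X ∧ ∀ Y : Set V, IsLambdaFragment G s Y → X.ncard ≤ Y.ncard

/-- The odd girth of `G`: the length of a shortest odd cycle of `G`. -/
noncomputable def oddGirth (G : SimpleGraph V) : ℕ :=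
  sInf {n | Odd n ∧ ∃ (v : V) (c : G.Walk v v), c.IsCycle ∧ c.length = n}

/-- `X` is an independent set of `G`. -/
def IsIndependentSet (G : SimpleGraph V) (X : Set V) : Prop :=
  ∀ x ∈ X, ∀ y ∈ X, ¬ G.Adj x y

/-- The independence number `α(G)`. -/
noncomputable def indepNum (G : SimpleGraph V) : ℕ :=
  sSup {n | ∃ X : Set V, IsIndependentSet G X ∧ X.ncard = n}

/-- The number of trivial (single-vertex) components of `G − X`. -/
noncomputable def trivialComponentCount (G : SimpleGraph V) (X : Set V) : ℕ :=
  {c : (G.induce Xᶜ).ConnectedComponent | c.supp.ncard = 1}.ncard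

/-- The number of odd components of `G − X`. -/
noncomputable def oddComponentCount (G : SimpleGraph V) (X : Set V) : ℕ :=
  {c : (G.induce Xᶜ).ConnectedComponent | Odd c.supp.ncard}.ncard

/-- The number of nontrivial components of `G − X`. -/
noncomputable def nontrivialComponentCount (G : SimpleGraph V) (X : Set V) : ℕ :=
  {c : (G.induce Xᶜ).ConnectedComponent | 2 ≤ c.supp.ncard}.ncard

/-- An imprimitive block of `G`: a proper non-empty vertex set that every
automorphism either fixes setwise or maps to a disjoint set. -/
def IsImprimitiveBlock (G : SimpleGraph V) (X : Set V) : Prop :=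
  X.Nonempty ∧ X ≠ Set.univ ∧ ∀ φ : G ≃g G, (⇑φ) '' X = X ∨ ((⇑φ) '' X) ∩ X = ∅

/-- A connected graph is `q`-extendable if it has a perfect matching and every
matching of size `q` is contained in a perfect matching. -/
def Extendable (G : SimpleGraph V) (q : ℕ) : Prop :=
  (∃ M : G.Subgraph, M.IsPerfectMatching) ∧
    ∀ M : G.Subgraph, M.IsMatching → M.edgeSet.ncard = q →
      ∃ P : G.Subgraph, P.IsPerfectMatching ∧ M ≤ P

end Defs


set_option linter.unusedSectionVars false

namespace VTProof

/-- Number of ordered adjacent pairs from `A` to `B`. -/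
def ee {V : Type*} (G : SimpleGraph V) [DecidableRel G.Adj] (A B : Finset V) : ℕ :=
  ∑ a ∈ A, ∑ b ∈ B, if G.Adj a b then 1 else 0

section cuts

variable {V : Type*} [Fintype V] [DecidableEq V] (G : SimpleGraph V) [DecidableRel G.Adj]

lemma ee_comm (A B : Finset V) : ee G A B = ee G B A := by
  unfold ee
  rw [Finset.sum_comm]
  simp only [G.adj_comm]

lemma ee_union_left {A A' : Finset V} (B : Finset V) (h : Disjoint A A') :
    ee G (A ∪ A') B = ee G A B + ee G A' B := by
  unfold ee
  rw [Finset.sum_union h]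

lemma ee_union_right {A A' : Finset V} (B : Finset V) (h : Disjoint A A') :
    ee G B (A ∪ A') = ee G B A + ee G B A' := by
  rw [ee_comm, ee_union_left G B h, ee_comm G A, ee_comm G A']

lemma ee_singleton (v : V) (B : Finset V) : ee G {v} B = (B.filter (G.Adj v)).card := by
  simp [ee]

lemma ee_univ (hreg : G.IsRegularOfDegree 6) (A : Finset V) :
    ee G A Finset.univ = 6 * A.card := by
  unfold ee
  have : ∀ a ∈ A, (∑ b, if G.Adj a b then 1 else 0) = 6 := by
    intro a _
    have := hreg a
    rw [← G.card_neighborFinset_eq_degree, G.neighborFinset_eq_filter] at this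
    simpa using this
  rw [Finset.sum_congr rfl this]
  simp [mul_comm]

lemma ee_compl (hreg : G.IsRegularOfDegree 6) (A : Finset V) :
    ee G A A + ee G A Aᶜ = 6 * A.card := by
  rw [← ee_univ G hreg A, ← ee_union_right G A disjoint_compl_right]
  simp

lemma ee_compl_compl (A : Finset V) : ee G Aᶜ Aᶜᶜ = ee G A Aᶜ := by
  rw [compl_compl, ee_comm]

lemma ee_mono {A A' B B' : Finset V} (hA : A ⊆ A') (hB : B ⊆ B') : ee G A B ≤ ee G A' B' := by
  unfold ee
  calc _ ≤ ∑ a ∈ A, ∑ b ∈ B', (if G.Adj a b then 1 else 0) :=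
        Finset.sum_le_sum fun a _ => Finset.sum_le_sum_of_subset hB
    _ ≤ _ := Finset.sum_le_sum_of_subset hA

lemma ee_eq_zero {A B : Finset V} (h : ∀ a ∈ A, ∀ b ∈ B, ¬ G.Adj a b) : ee G A B = 0 := by
  unfold ee
  refine Finset.sum_eq_zero fun a ha => Finset.sum_eq_zero fun b hb => ?_
  simp [h a ha b hb]

lemma mantel (htri : G.CliqueFree 3) (n : ℕ) :
    ∀ Z : Finset V, Z.card = n → 2 * ee G Z Z ≤ n ^ 2 := by
  induction n using Nat.strong_induction_on with
  | _ n ih =>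
    intro Z hZ
    by_cases h : ∀ a ∈ Z, ∀ b ∈ Z, ¬ G.Adj a b
    · rw [ee_eq_zero G h]; simp
    push Not at h
    obtain ⟨u, hu, v, hv, huv⟩ := h
    set P : Finset V := {u, v} with hP
    have hPc : P.card = 2 := Finset.card_pair huv.ne
    have hPZ : P ⊆ Z := by
      intro x hx; simp [hP] at hx; rcases hx with rfl | rfl <;> assumption
    set W := Z \ P with hW
    have hdis : Disjoint W P := Finset.sdiff_disjoint
    have hun : W ∪ P = Z := Finset.sdiff_union_of_subset hPZ
    have hWc : W.card = n - 2 := by rw [hW, Finset.card_sdiff_of_subset hPZ, hPc, hZ]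
    have hn : 2 ≤ n := by rw [← hZ, ← hPc]; exact Finset.card_le_card hPZ
    have h1 := ih (n - 2) (by omega) W hWc
    have h2 : ee G P W ≤ W.card := by
      unfold ee
      rw [Finset.sum_comm, Finset.card_eq_sum_ones]
      refine Finset.sum_le_sum fun w _ => ?_
      rw [hP, Finset.sum_pair huv.ne]
      by_cases h1 : G.Adj u w <;> by_cases h2 : G.Adj v w <;> simp [h1, h2]
      exact htri {u, v, w} (by rw [SimpleGraph.is3Clique_triple_iff]; exact ⟨huv, h1, h2⟩)
    have h3 : ee G P P = 2 := by
      unfold ee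
      rw [hP, Finset.sum_pair huv.ne, Finset.sum_pair huv.ne, Finset.sum_pair huv.ne]
      simp [huv, huv.symm]
    have h4 : ee G Z Z = ee G W W + 2 * ee G P W + 2 := by
      rw [← hun, ee_union_left G _ hdis, ee_union_right G _ hdis, ee_union_right G _ hdis, h3,
        ee_comm G W P]
      ring
    obtain ⟨m, rfl⟩ := Nat.exists_eq_add_of_le hn
    rw [h4]
    have : 2 + m - 2 = m := by omega
    rw [this] at h1 hWc
    nlinarith

lemma small_cut (hreg : G.IsRegularOfDegree 6) (htri : G.CliqueFree 3) (Z : Finset V)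
    (h3 : 3 ≤ Z.card) (h8 : Z.card ≤ 8) : 14 ≤ ee G Z Zᶜ := by
  have h1 := mantel G htri _ Z rfl
  have h2 := ee_compl G hreg Z
  generalize Z.card = k at *
  interval_cases k <;> omega

lemma small_cut' (hreg : G.IsRegularOfDegree 6) (htri : G.CliqueFree 3) (Z : Finset V)
    (h3 : 1 ≤ Z.card) (h8 : Z.card ≤ 8) : 6 ≤ ee G Z Zᶜ := by
  have h1 := mantel G htri _ Z rfl
  have h2 := ee_compl G hreg Z
  generalize Z.card = k at *
  interval_cases k <;> omega

lemma ncard_edgeBoundary (Z : Finset V) :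
    (edgeBoundary G (Z : Set V)).ncard = ee G Z Zᶜ := by
  have h : edgeBoundary G (Z : Set V) =
      (((Z ×ˢ Zᶜ).filter fun p => G.Adj p.1 p.2).image fun p => s(p.1, p.2) : Finset (Sym2 V)) := by
    ext e
    simp only [edgeBoundary, Set.mem_ofPred_eq, Finset.coe_image, Set.mem_image, Finset.coe_filter,
      Finset.mem_product, Finset.mem_compl, Set.mem_compl_iff, Finset.mem_coe, Prod.exists]
    constructor
    · rintro ⟨he, x, hx, y, hy, rfl⟩
      exact ⟨x, y, ⟨⟨hx, hy⟩, he⟩, rfl⟩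
    · rintro ⟨x, y, ⟨⟨hx, hy⟩, he⟩, rfl⟩
      exact ⟨he, x, hx, y, hy, rfl⟩
  rw [h, Set.ncard_coe_finset, Finset.card_image_of_injOn]
  · rw [Finset.card_filter, Finset.sum_product]; rfl
  · rintro ⟨a, b⟩ hab ⟨c, d⟩ hcd he
    simp at hab hcd he
    rcases he with ⟨rfl, rfl⟩ | ⟨rfl, rfl⟩
    · rfl
    · exact absurd hab.1.1 hcd.1.2

lemma cut_ge (hreg : G.IsRegularOfDegree 6) (htri : G.CliqueFree 3)
    (h5 : lambdaS G 5 = 18) (n : ℕ) :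
    ∀ Z : Finset V, ee G Z Zᶜ = n → 3 ≤ Z.card → 3 ≤ Zᶜ.card → 14 ≤ ee G Z Zᶜ := by
  classical
  induction n using Nat.strong_induction_on with
  | _ n ih =>
    intro Z hZ hc1 hc2
    by_cases hs1 : Z.card ≤ 8
    · exact small_cut G hreg htri Z hc1 hs1
    by_cases hs2 : Zᶜ.card ≤ 8
    · rw [← ee_compl_compl]; exact small_cut G hreg htri _ hc2 hs2
    push Not at hs1 hs2
    -- the generic reduction step
    have step : ∀ Y K : Finset V, ee G Y Yᶜ = n → 8 < Y.card → 8 < Yᶜ.card → K ⊆ Y →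
        1 ≤ K.card → K.card ≤ 4 → (∀ a ∈ K, ∀ b ∈ Y \ K, ¬ G.Adj a b) → 14 ≤ ee G Y Yᶜ := by
      intro Y K hY h1 h2 hKY hK1 hK4 hadj
      have hz := ee_eq_zero G hadj
      have hun : (Y \ K) ∪ K = Y := Finset.sdiff_union_of_subset hKY
      have hdis : Disjoint (Y \ K) K := Finset.sdiff_disjoint
      have hcK : Kᶜ = Yᶜ ∪ (Y \ K) := by
        ext x; simp; have := @hKY x; tauto
      have hcY : (Y \ K)ᶜ = Yᶜ ∪ K := by
        ext x; simp; have := @hKY x; tauto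
      have d1 : Disjoint Yᶜ (Y \ K) := by
        rw [Finset.disjoint_left]; intro x; simp; tauto
      have d2 : Disjoint Yᶜ K := by
        rw [Finset.disjoint_left]; intro x; simp; have := @hKY x; tauto
      have e1 : ee G K Kᶜ = ee G K Yᶜ := by
        rw [hcK, ee_union_right G _ d1, hz, add_zero]
      have e2 : ee G (Y \ K) (Y \ K)ᶜ = ee G (Y \ K) Yᶜ := by
        rw [hcY, ee_union_right G _ d2, ee_comm G (Y \ K) K, hz, add_zero]
      have e3 : ee G Y Yᶜ = ee G (Y \ K) Yᶜ + ee G K Yᶜ := by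
        conv_lhs => rw [← hun]
        rw [ee_union_left G _ hdis, hun]
      have h6 := small_cut' G hreg htri K hK1 (by omega)
      have hYK : (Y \ K).card = Y.card - K.card := Finset.card_sdiff_of_subset hKY
      have hc : (Y \ K)ᶜ.card ≥ Yᶜ.card := Finset.card_le_card (by rw [hcY]; exact Finset.subset_union_left)
      have := ih (ee G (Y \ K) (Y \ K)ᶜ) (by omega) (Y \ K) rfl (by omega) (by omega)
      omega
    by_cases hr : IsRestrictedEdgeCut G 5 (edgeBoundary G (Z : Set V))
    · have : lambdaS G 5 ≤ (edgeBoundary G (Z : Set V)).ncard := Nat.sInf_le ⟨_, hr, rfl⟩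
      rw [h5, ncard_edgeBoundary] at this
      omega
    -- adjacency in the deleted graph respects `Z`
    set H := G.deleteEdges (edgeBoundary G (Z : Set V)) with hH
    have hHadj : ∀ a b, H.Adj a b ↔ G.Adj a b ∧ (a ∈ Z ↔ b ∈ Z) := by
      intro a b
      rw [hH, SimpleGraph.deleteEdges_adj]
      refine and_congr_right fun hab => ?_
      simp only [edgeBoundary, Set.mem_ofPred_eq, SimpleGraph.mem_edgeSet, hab, true_and]
      constructor
      · intro h
        by_contra hne
        apply h
        by_cases ha : a ∈ Z
        · exact ⟨a, ha, b, by simp; tauto, rfl⟩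
        · exact ⟨b, by simp; tauto, a, by simpa using ha, Sym2.eq_swap⟩
      · rintro h ⟨x, hx, y, hy, he⟩
        simp at hx hy he
        rcases he with ⟨rfl, rfl⟩ | ⟨rfl, rfl⟩ <;> tauto
    have hreach : ∀ a b, H.Reachable a b → (a ∈ Z ↔ b ∈ Z) := by
      rintro a b ⟨w⟩
      induction w with
      | nil => rfl
      | cons h _ ih => rw [((hHadj _ _).1 h).2, ih]
    have hnc : ¬ H.Connected := by
      intro hcon
      obtain ⟨a, ha⟩ := Finset.card_pos.1 (by omega : 0 < Z.card)
      obtain ⟨b, hb⟩ := Finset.card_pos.1 (by omega : 0 < Zᶜ.card)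
      exact (Finset.mem_compl.1 hb) ((hreach a b (hcon.preconnected a b)).1 ha)
    have hex : ∃ c : H.ConnectedComponent, c.supp.ncard < 5 := by
      by_contra hcon
      push Not at hcon
      exact hr ⟨fun e he => he.1, hnc, hcon⟩
    obtain ⟨c, hc⟩ := hex
    obtain ⟨v, rfl⟩ := c.exists_rep
    set K : Finset V := Finset.univ.filter (fun w => H.Reachable w v) with hK
    have hKs : (H.connectedComponentMk v).supp = (K : Set V) := by
      ext w
      simp [hK, SimpleGraph.ConnectedComponent.mem_supp_iff, SimpleGraph.ConnectedComponent.eq]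
    have hK4 : K.card ≤ 4 := by
      have h : ((H.connectedComponentMk v).supp).ncard < 5 := hc
      rw [hKs, Set.ncard_coe_finset] at h
      omega
    have hK1 : 1 ≤ K.card := Finset.card_pos.2 ⟨v, by simp [hK]⟩
    by_cases hv : v ∈ Z
    · refine step Z K hZ hs1 hs2 ?_ hK1 hK4 ?_
      · intro w hw
        simp [hK] at hw
        exact (hreach _ _ hw).2 hv
      · intro a ha b hb hab
        simp [hK] at ha hb
        refine hb.2 (SimpleGraph.Reachable.trans (SimpleGraph.Adj.reachable ?_) ha)
        refine (hHadj _ _).2 ⟨hab.symm, ?_⟩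
        have := (hreach _ _ ha)
        tauto
    · rw [← ee_compl_compl]
      refine step Zᶜ K (by rw [ee_compl_compl]; exact hZ) hs2 (by rw [compl_compl]; exact hs1) ?_ hK1 hK4 ?_
      · intro w hw
        simp [hK] at hw
        rw [Finset.mem_compl, hreach _ _ hw]
        exact hv
      · intro a ha b hb hab
        simp [hK] at ha hb
        refine hb.2 (SimpleGraph.Reachable.trans (SimpleGraph.Adj.reachable ?_) ha)
        refine (hHadj _ _).2 ⟨hab.symm, ?_⟩
        have := (hreach _ _ ha)
        tauto

end cuts

section expansion

variable {V : Type*} [Fintype V] [DecidableEq V] (G : SimpleGraph V) [DecidableRel G.Adj]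

/-- The set of vertices having a neighbour in `F`. -/
def nb (F : Finset V) : Finset V := Finset.univ.filter fun v => ∃ u ∈ F, G.Adj u v

lemma mem_nb {F : Finset V} {v : V} : v ∈ nb G F ↔ ∃ u ∈ F, G.Adj u v := by simp [nb]

lemma nb_mono {F F' : Finset V} (h : F ⊆ F') : nb G F ⊆ nb G F' := by
  intro v; rw [mem_nb, mem_nb]; rintro ⟨u, hu, h'⟩; exact ⟨u, h hu, h'⟩

lemma nb_union (F F' : Finset V) : nb G (F ∪ F') = nb G F ∪ nb G F' := by
  ext v; simp only [mem_nb, Finset.mem_union]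
  constructor
  · rintro ⟨u, hu | hu, h⟩
    · exact Or.inl ⟨u, hu, h⟩
    · exact Or.inr ⟨u, hu, h⟩
  · rintro (⟨u, hu, h⟩ | ⟨u, hu, h⟩)
    · exact ⟨u, Or.inl hu, h⟩
    · exact ⟨u, Or.inr hu, h⟩

lemma nb_image (φ : G ≃g G) (F : Finset V) : nb G (F.image φ) = (nb G F).image φ := by
  ext v
  simp only [mem_nb, Finset.mem_image]
  constructor
  · rintro ⟨_, ⟨u, hu, rfl⟩, h⟩
    refine ⟨φ.symm v, ⟨u, hu, ?_⟩, by simp⟩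
    rw [← φ.map_adj_iff]; simpa using h
  · rintro ⟨w, ⟨u, hu, h⟩, rfl⟩
    exact ⟨φ u, ⟨u, hu, rfl⟩, φ.map_adj_iff.2 h⟩

lemma closed_univ (hconn : G.Connected) (W : Finset V) (hW : W.Nonempty)
    (h : ∀ a ∈ W, ∀ b, G.Adj a b → b ∈ W) : W = Finset.univ := by
  obtain ⟨a, ha⟩ := hW
  have key : ∀ x y, G.Reachable x y → x ∈ W → y ∈ W := by
    rintro x y ⟨w⟩
    induction w with
    | nil => exact id
    | cons hadj _ ih => exact fun hx => ih (h _ hx _ hadj)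
  ext y
  simp [key a y (hconn.preconnected a y) ha]

lemma nb_gt (hconn : G.Connected) (hnb : ¬ G.Colorable 2) (hreg : G.IsRegularOfDegree 6)
    (F : Finset V) (hF : F.Nonempty) (hne : nb G F ≠ Finset.univ) :
    F.card < (nb G F).card := by
  by_contra hlt
  push Not at hlt
  have h1 := ee_univ G hreg F
  have h2 := ee_univ G hreg (nb G F)
  have h3 : ee G F (nb G F)ᶜ = 0 := by
    apply ee_eq_zero
    intro a ha b hb hab
    rw [Finset.mem_compl] at hb
    exact hb ((mem_nb G).2 ⟨a, ha, hab⟩)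
  have h4 : ee G F Finset.univ = ee G F (nb G F) + ee G F (nb G F)ᶜ := by
    rw [← ee_union_right G F disjoint_compl_right]; simp
  have h5 : ee G (nb G F) Finset.univ = ee G (nb G F) F + ee G (nb G F) Fᶜ := by
    rw [← ee_union_right G _ disjoint_compl_right]; simp
  have h6 := ee_comm G F (nb G F)
  have h7 : ee G (nb G F) Fᶜ = 0 := by omega
  have h8 : ∀ a ∈ nb G F, ∀ b, G.Adj a b → b ∈ F := by
    intro a ha b hab
    by_contra hb
    have : ee G {a} {b} ≤ ee G (nb G F) Fᶜ :=
      ee_mono G (by simpa using ha) (by simpa using hb)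
    rw [h7] at this
    simp [ee, hab] at this
  have h9 : ∀ a ∈ F, ∀ b, G.Adj a b → b ∈ nb G F := fun a ha b hab => (mem_nb G).2 ⟨a, ha, hab⟩
  have hun : F ∪ nb G F = Finset.univ := by
    apply closed_univ G hconn _ (hF.mono Finset.subset_union_left)
    intro a ha b hab
    rw [Finset.mem_union] at ha ⊢
    rcases ha with ha | ha
    · exact Or.inr (h9 a ha b hab)
    · exact Or.inl (h8 a ha b hab)
  by_cases hi : (F ∩ nb G F).Nonempty
  · have : F ∩ nb G F = Finset.univ := by
      apply closed_univ G hconn _ hi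
      intro a ha b hab
      rw [Finset.mem_inter] at ha ⊢
      exact ⟨h8 a ha.2 b hab, h9 a ha.1 b hab⟩
    apply hne
    rw [← Finset.univ_subset_iff, ← this]
    exact Finset.inter_subset_right
  · rw [Finset.not_nonempty_iff_eq_empty] at hi
    apply hnb
    refine ⟨SimpleGraph.Coloring.mk (fun v => if v ∈ F then (0 : Fin 2) else 1) ?_⟩
    intro a b hab
    have hdis : ∀ x, x ∈ F → x ∈ nb G F → False := by
      intro x hx hx'
      have : x ∈ F ∩ nb G F := Finset.mem_inter.2 ⟨hx, hx'⟩
      rw [hi] at this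
      simp at this
    have hau : ∀ x, x ∈ F ∨ x ∈ nb G F := by
      intro x; rw [← Finset.mem_union, hun]; simp
    by_cases ha : a ∈ F
    · have hb : b ∉ F := fun hb => hdis b hb (h9 a ha b hab)
      simp [ha, hb]
    · have hb : b ∈ F := h8 a ((hau a).resolve_left ha) b hab
      simp [ha, hb]

lemma twins_of_expansion (hconn : G.Connected) (hvt : VertexTransitive G)
    (hnb : ¬ G.Colorable 2) (hreg : G.IsRegularOfDegree 6)
    (I : Finset V) (hI : I.Nonempty) (hIne : nb G I ≠ Finset.univ)
    (hI3 : (nb G I).card ≤ I.card + 3) :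
    ∀ v, (Finset.univ.filter fun w => ∀ x, G.Adj v x ↔ G.Adj w x).card = 3 := by
  classical
  have hex : ∃ d, ∃ F : Finset V, F.Nonempty ∧ nb G F ≠ Finset.univ ∧
      (nb G F).card = F.card + d := by
    have := nb_gt G hconn hnb hreg I hI hIne
    exact ⟨(nb G I).card - I.card, I, hI, hIne, by omega⟩
  obtain ⟨δ, hδ, hδmin⟩ : ∃ δ, (∃ F : Finset V, F.Nonempty ∧ nb G F ≠ Finset.univ ∧
      (nb G F).card = F.card + δ) ∧ ∀ F : Finset V, F.Nonempty → nb G F ≠ Finset.univ →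
      F.card + δ ≤ (nb G F).card := by
    refine ⟨Nat.find hex, Nat.find_spec hex, fun F hF hne => ?_⟩
    have := nb_gt G hconn hnb hreg F hF hne
    have := Nat.find_min' hex ⟨F, hF, hne, (by omega : (nb G F).card = F.card + ((nb G F).card - F.card))⟩
    omega
  have hex2 : ∃ m, ∃ F : Finset V, F.Nonempty ∧ nb G F ≠ Finset.univ ∧
      (nb G F).card = F.card + δ ∧ F.card = m := by
    obtain ⟨F, h1, h2, h3⟩ := hδ
    exact ⟨_, F, h1, h2, h3, rfl⟩
  obtain ⟨m, ⟨B, hB, hBne, hBδ, hBm⟩, hmmin⟩ : ∃ m, (∃ F : Finset V, F.Nonempty ∧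
      nb G F ≠ Finset.univ ∧ (nb G F).card = F.card + δ ∧ F.card = m) ∧
      ∀ F : Finset V, F.Nonempty → nb G F ≠ Finset.univ → (nb G F).card = F.card + δ →
        m ≤ F.card :=
    ⟨Nat.find hex2, Nat.find_spec hex2, fun F h1 h2 h3 => Nat.find_min' hex2 ⟨F, h1, h2, h3, rfl⟩⟩
  have hδ3 : δ ≤ 3 := by
    have := hδmin I hI hIne
    omega
  have hδ1 : 1 ≤ δ := by
    have := nb_gt G hconn hnb hreg B hB hBne
    omega
  -- the key uncrossing lemma
  have key : ∀ A F : Finset V, nb G A ≠ Finset.univ → (nb G A).card = A.card + δ → A.card = m →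
      nb G F ≠ Finset.univ → (nb G F).card = F.card + δ →
      F.card + m + δ ≤ Fintype.card V → (A ∩ F).Nonempty → A ⊆ F := by
    intro A F hA hAδ hAm hF hFδ hFn hne
    by_contra hsub
    have hlt : (A ∩ F).card < A.card := by
      apply Finset.card_lt_card
      refine ⟨Finset.inter_subset_left, fun h => hsub fun x hx => (Finset.mem_inter.1 (h hx)).2⟩
    have hine : nb G (A ∩ F) ≠ Finset.univ := by
      intro h
      apply hA
      rw [← Finset.univ_subset_iff, ← h]
      exact nb_mono G Finset.inter_subset_left
    have h1 := hδmin _ hne hine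
    have h2 : (nb G (A ∩ F)).card ≠ (A ∩ F).card + δ := by
      intro h
      have := hmmin _ hne hine h
      omega
    have h3 : (nb G (A ∩ F)).card ≤ (nb G A ∩ nb G F).card := Finset.card_le_card
      (Finset.subset_inter (nb_mono G Finset.inter_subset_left)
        (nb_mono G Finset.inter_subset_right))
    have h4 := Finset.card_union_add_card_inter (nb G A) (nb G F)
    have h5 := Finset.card_union_add_card_inter A F
    rw [← nb_union] at h4
    have hpos := hne.card_pos
    by_cases hu : nb G (A ∪ F) = Finset.univ
    · rw [hu, Finset.card_univ] at h4
      omega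
    · have := hδmin _ ((hne.mono Finset.inter_subset_left).mono Finset.subset_union_left) hu
      omega
  -- the dual of B
  set Bs := (nb G B)ᶜ with hBs
  have hBsc : Bs.card + (m + δ) = Fintype.card V := by
    have := Finset.card_compl_add_card (nb G B)
    rw [← hBm, ← hBδ]; exact this
  have hBs0 : Bs.Nonempty := by
    rw [Finset.nonempty_iff_ne_empty]
    intro h
    apply hBne
    rwa [hBs, Finset.compl_eq_empty_iff] at h
  have hnbBs : nb G Bs ⊆ Bᶜ := by
    intro v hv
    obtain ⟨u, hu, huv⟩ := (mem_nb G).1 hv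
    rw [Finset.mem_compl]
    intro hvB
    rw [hBs, Finset.mem_compl] at hu
    exact hu ((mem_nb G).2 ⟨v, hvB, huv.symm⟩)
  have hBsne : nb G Bs ≠ Finset.univ := by
    intro h
    obtain ⟨b, hb⟩ := hB
    have : b ∈ nb G Bs := by rw [h]; simp
    exact (Finset.mem_compl.1 (hnbBs this)) hb
  have hBsδ : (nb G Bs).card = Bs.card + δ := by
    have h1 := hδmin Bs hBs0 hBsne
    have h2 := Finset.card_le_card hnbBs
    have h3 := Finset.card_compl_add_card B
    omega
  have hBsm := hmmin Bs hBs0 hBsne hBsδ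
  -- atoms
  set at' : Finset V → Prop := fun A => nb G A ≠ Finset.univ ∧ (nb G A).card = A.card + δ ∧
    A.card = m with hat
  have hcov : ∀ v, ∃ A, at' A ∧ v ∈ A := by
    intro v
    obtain ⟨b, hb⟩ := hB
    obtain ⟨φ, hφ⟩ := hvt b v
    refine ⟨B.image φ, ⟨?_, ?_, ?_⟩, Finset.mem_image.2 ⟨b, hb, hφ⟩⟩
    · rw [nb_image]
      intro h
      apply hBne
      apply Finset.eq_univ_of_card
      rw [← Finset.card_image_of_injective _ φ.injective, h, Finset.card_univ]
    · rw [nb_image, Finset.card_image_of_injective _ φ.injective,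
        Finset.card_image_of_injective _ φ.injective, hBδ]
    · rw [Finset.card_image_of_injective _ φ.injective, hBm]
  have hdisj : ∀ A A', at' A → at' A' → A ≠ A' → Disjoint A A' := by
    intro A A' hA hA' hne
    rw [Finset.disjoint_iff_inter_eq_empty]
    by_contra hi
    rw [← ne_eq, ← Finset.nonempty_iff_ne_empty] at hi
    apply hne
    have h1 : A ⊆ A' := key A A' hA.1 hA.2.1 hA.2.2 hA'.1 hA'.2.1 (by rw [hA'.2.2]; omega) hi
    exact Finset.eq_of_subset_of_card_le h1 (by rw [hA.2.2, hA'.2.2])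
  have hdvd : m ∣ (nb G B).card := by
    set 𝒜 : Finset (Finset V) := Finset.univ.filter fun A => at' A ∧ A ⊆ nb G B with h𝒜
    have hunion : nb G B = 𝒜.biUnion id := by
      ext v
      simp only [Finset.mem_biUnion, id, h𝒜, Finset.mem_filter, Finset.mem_univ, true_and]
      constructor
      · intro hv
        obtain ⟨A, hA, hvA⟩ := hcov v
        refine ⟨A, ⟨hA, ?_⟩, hvA⟩
        intro w hw
        by_contra hwn
        have hwB : w ∈ Bs := by rw [hBs, Finset.mem_compl]; exact hwn
        have := key A Bs hA.1 hA.2.1 hA.2.2 hBsne hBsδ (by omega) ⟨w, Finset.mem_inter.2 ⟨hw, hwB⟩⟩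
        have := this hvA
        rw [hBs, Finset.mem_compl] at this
        exact this hv
      · rintro ⟨A, ⟨_, hs⟩, hv⟩
        exact hs hv
    rw [hunion, Finset.card_biUnion]
    · apply Finset.dvd_sum
      intro A hA
      simp only [h𝒜, Finset.mem_filter] at hA
      simp only [id]
      rw [hA.2.1.2.2]
    · intro A hA A' hA' hne
      have e1 := (Finset.mem_filter.1 (Finset.mem_coe.1 hA)).2
      have e2 := (Finset.mem_filter.1 (Finset.mem_coe.1 hA')).2
      exact hdisj A A' e1.1 e2.1 hne
  have hmδ : m ∣ δ := by
    rw [hBδ, hBm] at hdvd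
    exact (Nat.dvd_add_right (dvd_refl m)).1 hdvd
  have hmle : m ≤ δ := Nat.le_of_dvd (by omega) hmδ
  have hcard6 : ∀ v, (G.neighborFinset v).card = 6 := fun v => by
    rw [G.card_neighborFinset_eq_degree]; exact hreg v
  have hsub6 : ∀ (A : Finset V), ∀ a ∈ A, G.neighborFinset a ⊆ nb G A := by
    intro A a ha x hx
    exact (mem_nb G).2 ⟨a, ha, by simpa using hx⟩
  have h6 : 6 ≤ (nb G B).card := by
    obtain ⟨b, hb⟩ := hB
    rw [← hcard6 b]
    exact Finset.card_le_card (hsub6 B b hb)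
  have hm3 : m = 3 := by omega
  have hδ3' : δ = 3 := by omega
  intro v
  obtain ⟨A, hA, hvA⟩ := hcov v
  have hNA : ∀ a ∈ A, G.neighborFinset a = nb G A := by
    intro a ha
    apply Finset.eq_of_subset_of_card_le (hsub6 A a ha)
    rw [hA.2.1, hA.2.2, hcard6]; omega
  set T := Finset.univ.filter fun w => ∀ x, G.Adj v x ↔ G.Adj w x with hT
  have hvT : v ∈ T := by simp [hT]
  have hAT : A ⊆ T := by
    intro a ha
    simp only [hT, Finset.mem_filter, Finset.mem_univ, true_and]
    intro x
    rw [← G.mem_neighborFinset, ← G.mem_neighborFinset, hNA a ha, hNA v hvA]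
  have hnbT : nb G T = G.neighborFinset v := by
    ext x
    rw [mem_nb, G.mem_neighborFinset]
    constructor
    · rintro ⟨u, hu, h⟩
      simp only [hT, Finset.mem_filter] at hu
      exact (hu.2 x).2 h
    · intro h; exact ⟨v, hvT, h⟩
  have h1 := hδmin T ⟨v, hvT⟩ (by rw [hnbT, hNA v hvA]; exact hA.1)
  rw [hnbT, hcard6] at h1
  have h2 := Finset.card_le_card hAT
  have h3 := hA.2.2
  omega

end expansion

section twins

lemma two_regular_colorable {W : Type*} [Fintype W] [DecidableEq W] (H : SimpleGraph W)
    (hc : H.Connected) (h2 : ∀ a, (H.neighborSet a).ncard = 2) (hev : Even (Fintype.card W)) :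
    H.Colorable 2 := by
  classical
  have hcyc : H.IsCycles := fun v _ => h2 v
  obtain ⟨v⟩ := hc.nonempty
  have hne : (H.neighborSet v).Nonempty := by
    apply Set.nonempty_of_ncard_ne_zero
    rw [h2]; norm_num
  obtain ⟨p, hp, hpv⟩ := hcyc.exists_cycle_toSubgraph_verts_eq_connectedComponentSupp
    (c := H.connectedComponentMk v) (by simp) hne
  have hall : ∀ w, w ∈ p.support := by
    intro w
    have : w ∈ p.toSubgraph.verts := by
      rw [hpv, ConnectedComponent.mem_supp_iff, ConnectedComponent.eq]
      exact hc.preconnected w v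
    simpa using this
  have h3 : 3 ≤ p.length := hp.three_le_length
  have hidx : ∀ w, ∃ i, i < p.length ∧ p.getVert i = w := by
    intro w
    obtain ⟨i, hi, hile⟩ := Walk.mem_support_iff_exists_getVert.1 (hall w)
    rcases Nat.lt_or_ge i p.length with h | h
    · exact ⟨i, h, hi⟩
    · refine ⟨0, by omega, ?_⟩
      have : i = p.length := by omega
      rw [← hi, this]; simp
  choose f hf hfv using hidx
  have hinj := hp.getVert_injOn'
  have hfg : ∀ i, i < p.length → f (p.getVert i) = i := by
    intro i hi
    apply hinj
    · have := hf (p.getVert i)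
      simp only [Set.mem_ofPred_eq]; omega
    · simp only [Set.mem_ofPred_eq]; omega
    · exact hfv _
  have hlen : p.length = Fintype.card W := by
    have e : Fin p.length ≃ W :=
      { toFun := fun i => p.getVert i
        invFun := fun w => ⟨f w, hf w⟩
        left_inv := fun i => by
          apply Fin.ext; exact hfg i i.2
        right_inv := fun w => hfv w }
    rw [← Fintype.card_congr e, Fintype.card_fin]
  rw [← hlen] at hev
  have hedge : ∀ a b, H.Adj a b → ∃ i, s(p.getVert i, p.getVert (i+1)) = s(a, b) ∧ i < p.length := by
    intro a b hab
    rw [← Walk.toSubgraph_adj_iff]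
    have hsub : p.toSubgraph.neighborSet a ⊆ H.neighborSet a := p.toSubgraph.neighborSet_subset a
    have heq := Set.eq_of_subset_of_ncard_le hsub
      (by rw [h2, hp.ncard_neighborSet_toSubgraph_eq_two (hall a)])
    have : b ∈ p.toSubgraph.neighborSet a := by rw [heq]; exact hab
    exact this
  have key : ∀ i, i < p.length → f (p.getVert i) % 2 ≠ f (p.getVert (i+1)) % 2 := by
    intro i hi
    rw [hfg i hi]
    rcases Nat.lt_or_ge (i+1) p.length with h | h
    · rw [hfg _ h]; omega
    · have h' : i + 1 = p.length := by omega
      have h0 : p.getVert (i+1) = p.getVert 0 := by rw [h']; simp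
      rw [h0, hfg 0 (by omega)]
      obtain ⟨k, hk⟩ := hev
      omega
  refine ⟨Coloring.mk (fun w => (⟨f w % 2, Nat.mod_lt _ (by norm_num)⟩ : Fin 2)) ?_⟩
  intro a b hab h
  simp only [Fin.mk.injEq] at h
  obtain ⟨i, hi, hil⟩ := hedge a b hab
  have hk := key i hil
  rcases Sym2.eq_iff.1 hi with ⟨rfl, rfl⟩ | ⟨rfl, rfl⟩
  · exact hk h
  · exact hk h.symm

lemma twins_colorable {V : Type*} [Fintype V] [DecidableEq V] (G : SimpleGraph V)
    [DecidableRel G.Adj] (hconn : G.Connected) (hreg : G.IsRegularOfDegree 6)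
    (heven : Even (Fintype.card V))
    (htw : ∀ v, (Finset.univ.filter fun w => ∀ x, G.Adj v x ↔ G.Adj w x).card = 3) :
    G.Colorable 2 := by
  classical
  let r : Setoid V :=
    { r := fun v w => ∀ x, G.Adj v x ↔ G.Adj w x
      iseqv := ⟨fun _ _ => Iff.rfl, fun h x => (h x).symm, fun h h' x => (h x).trans (h' x)⟩ }
  let π : V → Quotient r := Quotient.mk r
  have hπ : ∀ v w, π v = π w ↔ ∀ x, G.Adj v x ↔ G.Adj w x := fun v w => Quotient.eq (r := r)
  have hout : ∀ a : Quotient r, π a.out = a := fun a => Quotient.out_eq a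
  let H : SimpleGraph (Quotient r) :=
    { Adj := fun a b => G.Adj a.out b.out
      symm := ⟨fun a b h => G.adj_symm h⟩
      loopless := ⟨fun a h => G.irrefl h⟩ }
  have hadj : ∀ x y, H.Adj (π x) (π y) ↔ G.Adj x y := by
    intro x y
    change G.Adj (π x).out (π y).out ↔ _
    have h1 := (hπ _ _).1 (hout (π x))
    have h2 := (hπ _ _).1 (hout (π y))
    rw [h1, G.adj_comm, h2, G.adj_comm]
  have hfib : ∀ a : Quotient r, (Finset.univ.filter fun w => π w = a).card = 3 := by
    intro a
    rw [← htw a.out]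
    congr 1
    ext w
    simp only [Finset.mem_filter, Finset.mem_univ, true_and]
    rw [← hπ, hout]
    exact eq_comm
  have hcard : ∀ s : Finset (Quotient r),
      (Finset.univ.filter fun w => π w ∈ s).card = 3 * s.card := by
    intro s
    rw [Finset.card_eq_sum_card_fiberwise (f := π) (t := s)]
    · rw [Finset.sum_congr rfl (g := fun _ => 3)]
      · simp [mul_comm]
      · intro a ha
        rw [← hfib a]
        congr 1
        ext w
        simp only [Finset.mem_filter, Finset.mem_univ, true_and]
        constructor
        · exact fun h => h.2
        · rintro rfl; exact ⟨ha, rfl⟩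
    · intro w hw
      simpa using hw
  have hcW : Fintype.card V = 3 * Fintype.card (Quotient r) := by
    have := hcard Finset.univ
    simpa using this
  have hevW : Even (Fintype.card (Quotient r)) := by
    rw [hcW, Nat.even_mul] at heven
    rcases heven with h | h
    · exact absurd h (by decide)
    · exact h
  have h2 : ∀ a, (H.neighborSet a).ncard = 2 := by
    intro a
    have h := hcard (H.neighborFinset a)
    have h6 : (Finset.univ.filter fun w => π w ∈ H.neighborFinset a) = G.neighborFinset a.out := by
      ext w
      simp only [Finset.mem_filter, Finset.mem_univ, true_and, mem_neighborFinset]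
      rw [← hadj a.out w, hout a]
    rw [h6, G.card_neighborFinset_eq_degree, hreg] at h
    rw [← coe_neighborFinset, Set.ncard_coe_finset]
    omega
  let φ : G →g H := ⟨π, fun {x y} h => (hadj x y).2 h⟩
  have hHc : H.Connected := by
    have : Nonempty (Quotient r) := hconn.nonempty.map π
    refine ⟨fun a b => ?_⟩
    have h := (hconn.preconnected a.out b.out).map φ
    have ea : φ a.out = a := hout a
    have eb : φ b.out = b := hout b
    rwa [ea, eb] at h
  obtain ⟨C⟩ := two_regular_colorable H hHc h2 hevW
  exact ⟨C.comp φ⟩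

end twins

section tutte

variable {V : Type*} [Fintype V] [DecidableEq V] (G : SimpleGraph V) [DecidableRel G.Adj]

lemma tutte_abstract (hreg : G.IsRegularOfDegree 6)
    (hcut : ∀ Z : Finset V, 3 ≤ Z.card → 3 ≤ Zᶜ.card → 14 ≤ ee G Z Zᶜ)
    {U : Type*} [Fintype U] (K : SimpleGraph U) (ι : U → V) (hι : Function.Injective ι)
    (hK : ∀ a b, G.Adj (ι a) (ι b) → K.Adj a b)
    (h4 : Fintype.card U + 4 ≤ Fintype.card V)
    (hq : Fintype.card V ≤ Fintype.card U + K.oddComponents.ncard + 2) :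
    ∃ I : Finset V, I.Nonempty ∧ nb G I ≠ Finset.univ ∧ (nb G I).card ≤ I.card + 3 := by
  classical
  set X : Finset V := (Finset.univ.image ι)ᶜ with hX
  have hXcard : X.card + Fintype.card U = Fintype.card V := by
    have h1 : (Finset.univ.image ι).card = Fintype.card U := by
      rw [Finset.card_image_of_injective _ hι, Finset.card_univ]
    have := Finset.card_add_card_compl (Finset.univ.image ι)
    rw [h1] at this
    rw [hX]
    omega
  let Z : K.ConnectedComponent → Finset V := fun c =>
    (Finset.univ.filter fun z => K.connectedComponentMk z = c).image ι
  have memZ : ∀ c v, v ∈ Z c ↔ ∃ z, K.connectedComponentMk z = c ∧ ι z = v := by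
    intro c v
    simp [Z]
  have hZcard : ∀ c, (Z c).card = c.supp.ncard := by
    intro c
    have : c.supp = ((Finset.univ.filter fun z => K.connectedComponentMk z = c : Finset U) : Set U) := by
      ext z; simp
    rw [this, Set.ncard_coe_finset, Finset.card_image_of_injective _ hι]
  have hZdisj : ∀ c c', c ≠ c' → Disjoint (Z c) (Z c') := by
    intro c c' hne
    rw [Finset.disjoint_left]
    intro v h1 h2
    obtain ⟨z, hz, rfl⟩ := (memZ _ _).1 h1
    obtain ⟨z', hz', h⟩ := (memZ _ _).1 h2
    have := hι h
    subst this
    exact hne (hz.symm.trans hz')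
  have hZX : ∀ c, Disjoint (Z c) X := by
    intro c
    rw [Finset.disjoint_left]
    intro v h1 h2
    obtain ⟨z, hz, rfl⟩ := (memZ _ _).1 h1
    simp [hX] at h2
  have hclosed : ∀ c, ∀ v ∈ Z c, ∀ w, w ∉ X → G.Adj v w → w ∈ Z c := by
    intro c v hv w hw hvw
    obtain ⟨z, hz, rfl⟩ := (memZ _ _).1 hv
    have hw' : ∃ y, ι y = w := by simpa [hX] using hw
    obtain ⟨y, rfl⟩ := hw'
    refine (memZ _ _).2 ⟨y, ?_, rfl⟩
    rw [← hz]
    exact (ConnectedComponent.connectedComponentMk_eq_of_adj (hK _ _ hvw)).symm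
  have hcutX : ∀ c, ee G (Z c) (Z c)ᶜ = ee G (Z c) X := by
    intro c
    have hsub : X ⊆ (Z c)ᶜ := by
      intro x hx
      rw [Finset.mem_compl]
      exact fun h => Finset.disjoint_left.1 (hZX c) h hx
    have h0 : ee G (Z c) ((Z c)ᶜ \ X) = 0 := by
      unfold ee
      apply Finset.sum_eq_zero
      intro a ha
      apply Finset.sum_eq_zero
      intro b hb
      rw [Finset.mem_sdiff, Finset.mem_compl] at hb
      rw [if_neg]
      exact fun h => hb.1 (hclosed c a ha b hb.2 h)
    have hu : (Z c)ᶜ = X ∪ ((Z c)ᶜ \ X) := (Finset.union_sdiff_of_subset hsub).symm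
    rw [hu, ee_union_right G _ Finset.disjoint_sdiff, h0, add_zero]
  set D1 : Finset K.ConnectedComponent := Finset.univ.filter fun c => (Z c).card = 1 with hD1
  set D2 : Finset K.ConnectedComponent :=
    Finset.univ.filter fun c => Odd (Z c).card ∧ (Z c).card ≠ 1 with hD2
  have hdis : Disjoint D1 D2 := by
    rw [Finset.disjoint_left]
    intro c h1 h2
    simp only [hD1, hD2, Finset.mem_filter] at h1 h2
    exact h2.2.2 h1.2
  have hodd : K.oddComponents.ncard = D1.card + D2.card := by
    have : K.oddComponents = ((D1 ∪ D2 : Finset K.ConnectedComponent) : Set _) := by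
      ext c
      simp only [hD1, hD2, oddComponents, Finset.coe_union, Finset.coe_filter, Set.mem_union,
        Set.mem_ofPred_eq, Finset.mem_univ, true_and, ← hZcard]
      constructor
      · intro h
        by_cases h1 : (Z c).card = 1
        · exact Or.inl h1
        · exact Or.inr ⟨h, h1⟩
      · rintro (h | h)
        · rw [h]; exact odd_one
        · exact h.1
    rw [this, Set.ncard_coe_finset, Finset.card_union_of_disjoint hdis]
  have hpd : ∀ D : Finset K.ConnectedComponent, (D : Set K.ConnectedComponent).PairwiseDisjoint Z :=
    fun D c _ c' _ hne => hZdisj c c' hne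
  have hsum : ∑ c ∈ D1 ∪ D2, ee G (Z c) X ≤ 6 * X.card := by
    rw [← ee_univ G hreg X, ee_comm G X]
    have : ∑ c ∈ D1 ∪ D2, ee G (Z c) X = ee G ((D1 ∪ D2).biUnion Z) X := by
      unfold ee
      rw [Finset.sum_biUnion (hpd _)]
    rw [this]
    unfold ee
    exact Finset.sum_le_sum_of_subset (Finset.subset_univ _)
  rw [Finset.sum_union hdis] at hsum
  have hs1 : 6 * D1.card ≤ ∑ c ∈ D1, ee G (Z c) X := by
    rw [mul_comm, ← smul_eq_mul]
    apply Finset.card_nsmul_le_sum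
    intro c hc
    have h1 : (Z c).card = 1 := (Finset.mem_filter.1 hc).2
    have h2 := ee_compl G hreg (Z c)
    obtain ⟨v, hv⟩ := Finset.card_eq_one.1 h1
    have h3 : ee G (Z c) (Z c) = 0 := by rw [hv]; simp [ee]
    rw [← hcutX]
    omega
  have hs2 : 14 * D2.card ≤ ∑ c ∈ D2, ee G (Z c) X := by
    rw [mul_comm, ← smul_eq_mul]
    apply Finset.card_nsmul_le_sum
    intro c hc
    obtain ⟨⟨k, hk⟩, h1⟩ := (Finset.mem_filter.1 hc).2
    rw [← hcutX]
    apply hcut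
    · omega
    · have hsub : X ⊆ (Z c)ᶜ := by
        intro x hx
        rw [Finset.mem_compl]
        exact fun h => Finset.disjoint_left.1 (hZX c) h hx
      have := Finset.card_le_card hsub
      omega
  have hD1c : X.card ≤ D1.card + 3 := by omega
  have hIc : (D1.biUnion Z).card = D1.card := by
    rw [Finset.card_biUnion (hpd _), Finset.sum_congr rfl (g := fun _ => 1)]
    · simp
    · intro c hc; exact (Finset.mem_filter.1 hc).2
  have hnbX : nb G (D1.biUnion Z) ⊆ X := by
    intro w hw
    obtain ⟨v, hv, hvw⟩ := (mem_nb G).1 hw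
    obtain ⟨c, hc, hvc⟩ := Finset.mem_biUnion.1 hv
    by_contra hwX
    have hwc := hclosed c v hvc w hwX hvw
    obtain ⟨a, ha⟩ := Finset.card_eq_one.1 (Finset.mem_filter.1 hc).2
    rw [ha, Finset.mem_singleton] at hvc hwc
    subst hvc
    subst hwc
    exact G.irrefl hvw
  have hIne : (D1.biUnion Z).Nonempty := by
    rw [← Finset.card_pos]; omega
  refine ⟨D1.biUnion Z, hIne, ?_, ?_⟩
  · intro h
    obtain ⟨v, hv⟩ := hIne
    obtain ⟨c, hc, hvc⟩ := Finset.mem_biUnion.1 hv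
    exact Finset.disjoint_left.1 (hZX c) hvc (hnbX (h ▸ Finset.mem_univ v))
  · have := Finset.card_le_card hnbX
    omega

lemma tutte_step (hreg : G.IsRegularOfDegree 6)
    (hcut : ∀ Z : Finset V, 3 ≤ Z.card → 3 ≤ Zᶜ.card → 14 ≤ ee G Z Zᶜ)
    (heven : Even (Fintype.card V)) (hnfc : ¬ PFactorCritical G 4) :
    ∃ I : Finset V, I.Nonempty ∧ nb G I ≠ Finset.univ ∧ (nb G I).card ≤ I.card + 3 := by
  classical
  unfold PFactorCritical at hnfc
  push Not at hnfc
  obtain ⟨Y, hY, hM⟩ := hnfc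
  have hYc : Nat.card (Yᶜ : Set V) + 4 = Fintype.card V := by
    have := Set.ncard_add_ncard_compl Y
    rw [hY, Nat.card_eq_fintype_card] at this
    rw [Nat.card_coe_set_eq]
    omega
  have hev : Even (Nat.card (Yᶜ : Set V)) := by
    obtain ⟨k, hk⟩ := heven
    exact ⟨k - 2, by omega⟩
  obtain ⟨u, hu⟩ := exists_isTutteViolator hM hev
  unfold IsTutteViolator at hu
  set P := (⊤ : (G.induce Yᶜ).Subgraph).deleteVerts u with hP
  have hverts : P.verts = uᶜ := by
    rw [hP, Subgraph.deleteVerts_verts]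
    ext; simp
  have hPc : u.ncard + Nat.card P.verts = Nat.card (Yᶜ : Set V) := by
    rw [Nat.card_coe_set_eq, hverts]
    exact Set.ncard_add_ncard_compl u
  have hpar := odd_ncard_oddComponents (G := P.coe)
  have hq : u.ncard + 2 ≤ P.coe.oddComponents.ncard := by
    by_contra hlt
    have heq : P.coe.oddComponents.ncard = u.ncard + 1 := by omega
    rw [heq] at hpar
    simp only [Nat.odd_iff] at hpar
    rw [Nat.even_iff] at hev
    omega
  have hfin : Fintype.card P.verts = Nat.card P.verts := Fintype.card_eq_nat_card
  refine tutte_abstract G hreg hcut P.coe (fun z => z.1.1)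
    (fun a b h => Subtype.ext (Subtype.ext h)) ?_ ?_ ?_
  · intro a b hab
    have ha : a.1 ∉ u := hverts.subset a.2
    have hb : b.1 ∉ u := hverts.subset b.2
    rw [Subgraph.coe_adj]
    refine Subgraph.deleteVerts_adj.2 ?_
    simp [ha, hb, hab]
  · omega
  · omega

end tutte

end VTProof

/-- (Lemma 3.10) `G` connected vertex-transitive non-bipartite
triangle-free of degree 6 and even order, not 4-factor-critical, with
`λ₅(G) = λ₈(G) = 18`. Then every `λ₈`-atom `S` of `G` satisfies `|S| ≥ 15`. -/
theorem statement18 {V : Type*} [Fintype V] [DecidableEq V]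
    (G : SimpleGraph V) [DecidableRel G.Adj]
    (hconn : G.Connected) (hvt : VertexTransitive G) (hnb : ¬ G.Colorable 2)
    (htri : G.CliqueFree 3) (hreg : G.IsRegularOfDegree 6)
    (heven : Even (Fintype.card V)) (hnfc : ¬ PFactorCritical G 4)
    (h5 : lambdaS G 5 = 18) (h8 : lambdaS G 8 = 18)
    (S : Set V) (hS : IsLambdaAtom G 8 S) :
    15 ≤ S.ncard := by
  exfalso
  obtain ⟨I, hI, hIne, hI3⟩ := VTProof.tutte_step G hreg
    (fun Z h1 h2 => VTProof.cut_ge G hreg htri h5 _ Z rfl h1 h2) heven hnfc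
  exact hnb (VTProof.twins_colorable G hconn hreg heven
    (VTProof.twins_of_expansion G hconn hvt hnb hreg I hI hIne hI3))
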